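/- (Restriction uncertainty principle for linear subvarieties.) Let n ≥ k ≥ 1 be integers, let 0 < β < k, and set α = n − k + β (so n − α = k − β and 0 < α < n). For f ∈ 𝒮(ℝ^n), let g(x) = |x|^{β/2} f(x) and let ĝ(ξ) = ∫_{ℝ^n} e^{2πi x·ξ} g(x) dx be its Fourier transform. Then d · ∫_{ℝ^k} |f(u, 0)|² du ≤ ∫_{ℝ^n} |ξ|^{α} |ĝ(ξ)|² dξ, where (u,0) ∈ ℝ^k × ℝ^{n−k} = ℝ^n and d = π^{−α} · [Γ(α/2)/Γ(β/2)] · [Γ((k+β)/4)/Γ((k−β)/4)]². -/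

import Mathlib

open MeasureTheory Real
open scoped ENNReal InnerProductSpace

noncomputable section

/-- The embedding `ℝ^k → ℝ^n`, `u ↦ (u, 0)`. -/
def embedSub {k n : ℕ} (hkn : k ≤ n) (u : EuclideanSpace ℝ (Fin k)) :
    EuclideanSpace ℝ (Fin n) :=
  (EuclideanSpace.equiv (Fin n) ℝ).symm
    (fun i => if h : (i : ℕ) < k then u ⟨i, h⟩ else 0)

/-- Euler's integral for the Gamma function, rescaled. -/
theorem lintegral_rpow_mul_exp_neg_mul {s r : ℝ} (hs : 0 < s) (hr : 0 < r) :
    ∫⁻ t in Set.Ioi (0 : ℝ), ENNReal.ofReal (t ^ (s - 1) * exp (-(r * t))) =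
      ENNReal.ofReal (Gamma s * r ^ (-s)) := by
  have h := integral_rpow_mul_exp_neg_mul_Ioi hs hr
  rw [← ofReal_integral_eq_lintegral_ofReal, h, one_div, inv_rpow hr.le, rpow_neg hr.le, mul_comm]
  · refine Integrable.of_integral_ne_zero ?_
    rw [h]
    have := Gamma_pos_of_pos hs
    positivity
  · filter_upwards [ae_restrict_mem measurableSet_Ioi] with t (ht : 0 < t)
    simp only [Pi.zero_apply]
    positivity

/-- Euler's integral for the Gamma function after inverting the variable. -/
theorem lintegral_rpow_mul_exp_neg_div {s r : ℝ} (hs : 0 < s) (hr : 0 < r) :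
    ∫⁻ t in Set.Ioi (0 : ℝ), ENNReal.ofReal (t ^ (-s - 1) * exp (-(r / t))) =
      ENNReal.ofReal (Gamma s * r ^ (-s)) := by
  have h0 : ∫ t in Set.Ioi (0 : ℝ), t ^ (-s - 1) * exp (-(r / t)) = Gamma s * r ^ (-s) := by
    have h := integral_comp_rpow_Ioi (fun t : ℝ => t ^ (s - 1) * exp (-(r * t)))
      (p := -1) (by norm_num)
    rw [integral_rpow_mul_exp_neg_mul_Ioi hs hr, one_div, inv_rpow hr.le, ← rpow_neg hr.le,
      mul_comm] at h
    rw [← h]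
    refine setIntegral_congr_fun measurableSet_Ioi fun t (ht : 0 < t) => ?_
    simp only [smul_eq_mul]
    rw [← rpow_mul ht.le, rpow_neg_one, ← div_eq_mul_inv, abs_neg, abs_one, one_mul, ← mul_assoc,
      ← rpow_add ht]
    ring_nf
  rw [← ofReal_integral_eq_lintegral_ofReal, h0]
  · refine Integrable.of_integral_ne_zero ?_
    rw [h0]
    have := Gamma_pos_of_pos hs
    positivity
  · filter_upwards [ae_restrict_mem measurableSet_Ioi] with t (ht : 0 < t)
    simp only [Pi.zero_apply]
    positivity

/-- The Beta integral over the half-line, as a quotient of Gamma values. -/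
theorem lintegral_rpow_mul_one_add_rpow {p q : ℝ} (hp : 0 < p) (hq : 0 < q) :
    ∫⁻ y in Set.Ioi (0 : ℝ), ENNReal.ofReal (y ^ (q - 1) * (1 + y) ^ (-(p + q))) =
      ENNReal.ofReal (Gamma p * Gamma q / Gamma (p + q)) := by
  have hG := Gamma_pos_of_pos (add_pos hp hq)
  have hGq := Gamma_pos_of_pos hq
  have h1 : ∀ y ∈ Set.Ioi (0 : ℝ),
      ENNReal.ofReal (y ^ (q - 1) * (1 + y) ^ (-(p + q))) =
      ENNReal.ofReal (Gamma (p + q))⁻¹ * ∫⁻ z in Set.Ioi (0 : ℝ),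
        ENNReal.ofReal (y ^ (q - 1) * (z ^ (p + q - 1) * exp (-((1 + y) * z)))) := by
    intro y (hy : 0 < y)
    have hy' : 0 ≤ y ^ (q - 1) := by positivity
    simp_rw [ENNReal.ofReal_mul hy']
    rw [lintegral_const_mul _ (by fun_prop),
      lintegral_rpow_mul_exp_neg_mul (add_pos hp hq) (by positivity),
      ← ENNReal.ofReal_mul (by positivity), ← ENNReal.ofReal_mul (by positivity),
      ← ENNReal.ofReal_mul (by positivity)]
    congr 1
    field_simp
  have h2 : ∀ z ∈ Set.Ioi (0 : ℝ), ∫⁻ y in Set.Ioi (0 : ℝ),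
        ENNReal.ofReal (y ^ (q - 1) * (z ^ (p + q - 1) * exp (-((1 + y) * z)))) =
      ENNReal.ofReal (Gamma q) * ENNReal.ofReal (z ^ (p - 1) * exp (-(1 * z))) := by
    intro z (hz : 0 < z)
    have hz' : 0 ≤ z ^ (p + q - 1) * exp (-z) := by positivity
    have h3 : ∀ y : ℝ, y ^ (q - 1) * (z ^ (p + q - 1) * exp (-((1 + y) * z))) =
        (z ^ (p + q - 1) * exp (-z)) * (y ^ (q - 1) * exp (-(z * y))) := by
      intro y
      rw [show -((1 + y) * z) = -z + -(z * y) by ring, exp_add]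
      ring
    simp_rw [h3, ENNReal.ofReal_mul hz']
    rw [lintegral_const_mul _ (by fun_prop), lintegral_rpow_mul_exp_neg_mul hq hz,
      ← ENNReal.ofReal_mul hz', ← ENNReal.ofReal_mul hGq.le]
    congr 1
    rw [show p - 1 = p + q - 1 + -q by ring, rpow_add hz, one_mul]
    ring
  rw [setLIntegral_congr_fun measurableSet_Ioi h1, lintegral_const_mul' _ _ ENNReal.ofReal_ne_top,
    lintegral_lintegral_swap (by fun_prop), setLIntegral_congr_fun measurableSet_Ioi h2,
    lintegral_const_mul' _ _ ENNReal.ofReal_ne_top, lintegral_rpow_mul_exp_neg_mul hp one_pos,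
    ← ENNReal.ofReal_mul (by positivity), ← ENNReal.ofReal_mul (by positivity)]
  congr 1
  rw [one_rpow]
  field_simp

section Gaussian

variable {V : Type*} [NormedAddCommGroup V] [InnerProductSpace ℝ V] [FiniteDimensional ℝ V]
  [MeasurableSpace V] [BorelSpace V]

theorem lintegral_exp_neg_mul_sq_norm {b : ℝ} (hb : 0 < b) :
    ∫⁻ v : V, ENNReal.ofReal (exp (-b * ‖v‖ ^ 2)) =
      ENNReal.ofReal ((π / b) ^ (Module.finrank ℝ V / 2 : ℝ)) := by
  have h := GaussianFourier.integral_rexp_neg_mul_sq_norm (V := V) hb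
  rw [← ofReal_integral_eq_lintegral_ofReal, h]
  · refine Integrable.of_integral_ne_zero ?_
    rw [h]
    positivity
  · filter_upwards with t using (exp_pos _).le

/-- The convolution of two Gaussians is a Gaussian. -/
theorem lintegral_exp_mul_exp {t s : ℝ} (ht : 0 < t) (hs : 0 < s) (x : V) :
    ∫⁻ y : V, ENNReal.ofReal (exp (-(π * ‖x - y‖ ^ 2 / t)) * exp (-(π * ‖y‖ ^ 2 / s))) =
      ENNReal.ofReal ((t * s / (t + s)) ^ (Module.finrank ℝ V / 2 : ℝ) *
        exp (-(π * ‖x‖ ^ 2 / (t + s)))) := by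
  have hts := add_pos ht hs
  have h1 : ∀ y : V, exp (-(π * ‖x - y‖ ^ 2 / t)) * exp (-(π * ‖y‖ ^ 2 / s)) =
      exp (-(π * ‖x‖ ^ 2 / (t + s))) *
        exp (-(π * (t + s) / (t * s)) * ‖y - (s / (t + s)) • x‖ ^ 2) := by
    intro y
    rw [← exp_add, ← exp_add, norm_sub_sq_real, norm_sub_sq_real, norm_smul, inner_smul_right,
      real_inner_comm x y, norm_of_nonneg (by positivity)]
    congr 1
    field_simp
    ring
  simp_rw [h1, ENNReal.ofReal_mul (exp_pos _).le]
  rw [lintegral_const_mul' _ _ ENNReal.ofReal_ne_top,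
    lintegral_sub_right_eq_self
      (fun y : V => ENNReal.ofReal (exp (-(π * (t + s) / (t * s)) * ‖y‖ ^ 2))),
    lintegral_exp_neg_mul_sq_norm (by positivity), mul_comm, ENNReal.ofReal_mul (by positivity)]
  congr 3
  field_simp

end Gaussian

section Riesz

variable {V : Type*} [NormedAddCommGroup V] [InnerProductSpace ℝ V]

theorem lintegral_Ioi_eq_mul_lintegral_comp_mul_left (f : ℝ → ℝ≥0∞) {t : ℝ} (ht : 0 < t) :
    ∫⁻ s in Set.Ioi (0 : ℝ), f s = ∫⁻ y in Set.Ioi (0 : ℝ), ENNReal.ofReal t * f (t * y) := by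
  have h := lintegral_image_eq_lintegral_abs_deriv_mul (s := Set.Ioi (0 : ℝ))
    (f := fun y => t * y) (f' := fun _ => t) measurableSet_Ioi
    (fun y _ => by simpa using ((hasDerivAt_id y).const_mul t).hasDerivWithinAt)
    (fun y _ z _ hyz => mul_left_cancel₀ ht.ne' hyz) f
  rw [Set.image_mul_left_Ioi ht, mul_zero, abs_of_pos ht] at h
  exact h

/-- The superposition of Gaussians proportional to the Riesz kernel of order `2 * p`. -/
def rieszKernel (p : ℝ) (x : V) : ℝ≥0∞ :=
  ∫⁻ t in Set.Ioi (0 : ℝ),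
    ENNReal.ofReal (t ^ (p - Module.finrank ℝ V / 2 - 1) * exp (-(π * ‖x‖ ^ 2 / t)))

theorem rieszKernel_eq {p : ℝ} (hp : p < Module.finrank ℝ V / 2) {x : V} (hx : x ≠ 0) :
    rieszKernel p x = ENNReal.ofReal
      (Gamma (Module.finrank ℝ V / 2 - p) * (π * ‖x‖ ^ 2) ^ (p - Module.finrank ℝ V / 2)) := by
  have hx' := norm_pos_iff.2 hx
  have h := lintegral_rpow_mul_exp_neg_div (s := Module.finrank ℝ V / 2 - p) (r := π * ‖x‖ ^ 2)
    (by linarith) (by positivity)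
  rw [neg_sub] at h
  exact h

variable [MeasurableSpace V] [BorelSpace V]

theorem measurable_rieszKernel (p : ℝ) : Measurable (rieszKernel p : V → ℝ≥0∞) := by
  unfold rieszKernel
  exact Measurable.lintegral_prod_right' (f := fun z : V × ℝ => ENNReal.ofReal
    (z.2 ^ (p - Module.finrank ℝ V / 2 - 1) * exp (-(π * ‖z.1‖ ^ 2 / z.2)))) (by fun_prop)

/-- Integrating the convolution of two Gaussians against powers of their widths. -/
theorem lintegral_lintegral_add_rpow {p q D r : ℝ} (hp : 0 < p) (hq : 0 < q)
    (hpq : p + q < D) (hr : 0 < r) :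
    ∫⁻ t in Set.Ioi (0 : ℝ), ∫⁻ s in Set.Ioi (0 : ℝ), ENNReal.ofReal
      (t ^ (p - 1) * s ^ (q - 1) * (t + s) ^ (-D) * exp (-(r / (t + s)))) =
    ENNReal.ofReal (Gamma p * Gamma q / Gamma (p + q) *
      (Gamma (D - p - q) * r ^ (-(D - p - q)))) := by
  have h1 : ∀ t ∈ Set.Ioi (0 : ℝ), ∫⁻ s in Set.Ioi (0 : ℝ), ENNReal.ofReal
      (t ^ (p - 1) * s ^ (q - 1) * (t + s) ^ (-D) * exp (-(r / (t + s)))) =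
      ∫⁻ y in Set.Ioi (0 : ℝ), ENNReal.ofReal ((y ^ (q - 1) * (1 + y) ^ (-D)) *
        (t ^ (-(D - p - q) - 1) * exp (-((r / (1 + y)) / t)))) := by
    intro t (ht : 0 < t)
    rw [lintegral_Ioi_eq_mul_lintegral_comp_mul_left _ ht]
    refine setLIntegral_congr_fun measurableSet_Ioi fun y (hy : 0 < y) => ?_
    rw [← ENNReal.ofReal_mul ht.le]
    congr 1
    have e1 : t + t * y = t * (1 + y) := by ring
    have e2 : r / (t * (1 + y)) = r / (1 + y) / t := by field_simp
    have e3 : t ^ (-(D - p - q) - 1) = t * (t ^ (p - 1) * t ^ (q - 1) * t ^ (-D)) := by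
      rw [← rpow_add ht, ← rpow_add ht, ← rpow_one_add' ht.le (by linarith)]
      ring_nf
    rw [e1, e2, e3, mul_rpow ht.le hy.le, mul_rpow ht.le (by positivity)]
    ring
  have h2 : ∀ y ∈ Set.Ioi (0 : ℝ), ∫⁻ t in Set.Ioi (0 : ℝ),
      ENNReal.ofReal ((y ^ (q - 1) * (1 + y) ^ (-D)) *
        (t ^ (-(D - p - q) - 1) * exp (-((r / (1 + y)) / t)))) =
      ENNReal.ofReal (y ^ (q - 1) * (1 + y) ^ (-(p + q))) *
        ENNReal.ofReal (Gamma (D - p - q) * r ^ (-(D - p - q))) := by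
    intro y (hy : 0 < y)
    have hy1 : 0 < 1 + y := by linarith
    simp_rw [ENNReal.ofReal_mul (show 0 ≤ y ^ (q - 1) * (1 + y) ^ (-D) by positivity)]
    rw [lintegral_const_mul' _ _ ENNReal.ofReal_ne_top,
      lintegral_rpow_mul_exp_neg_div (by linarith) (by positivity),
      ← ENNReal.ofReal_mul (by positivity), ← ENNReal.ofReal_mul (by positivity)]
    congr 1
    rw [div_rpow hr.le hy1.le, show -(p + q) = -D - (-(D - p - q)) by ring, rpow_sub hy1]
    ring
  have hG := Gamma_pos_of_pos (add_pos hp hq)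
  have hGq := Gamma_pos_of_pos hq
  have hGp := Gamma_pos_of_pos hp
  rw [setLIntegral_congr_fun measurableSet_Ioi h1, lintegral_lintegral_swap (by fun_prop),
    setLIntegral_congr_fun measurableSet_Ioi h2, lintegral_mul_const' _ _ ENNReal.ofReal_ne_top,
    lintegral_rpow_mul_one_add_rpow hp hq, ← ENNReal.ofReal_mul (by positivity)]

variable [FiniteDimensional ℝ V]

/-- The composition formula for Riesz kernels. -/
theorem lintegral_rieszKernel_mul_rieszKernel {p q : ℝ} (hp : 0 < p) (hq : 0 < q)
    (hpq : p + q < Module.finrank ℝ V / 2) {x : V} (hx : x ≠ 0) :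
    ∫⁻ y : V, rieszKernel p (x - y) * rieszKernel q y =
      ENNReal.ofReal (Gamma p * Gamma q / Gamma (p + q) *
        (Gamma (Module.finrank ℝ V / 2 - p - q) *
          (π * ‖x‖ ^ 2) ^ (-(Module.finrank ℝ V / 2 - p - q)))) := by
  have hx' := norm_pos_iff.2 hx
  rw [← lintegral_lintegral_add_rpow hp hq hpq (by positivity)]
  set D : ℝ := Module.finrank ℝ V / 2 with hD
  have h1 : ∀ y : V, rieszKernel p (x - y) * rieszKernel q y =
      ∫⁻ t in Set.Ioi (0 : ℝ), ∫⁻ s in Set.Ioi (0 : ℝ),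
        ENNReal.ofReal (t ^ (p - D - 1) * exp (-(π * ‖x - y‖ ^ 2 / t))) *
        ENNReal.ofReal (s ^ (q - D - 1) * exp (-(π * ‖y‖ ^ 2 / s))) := by
    intro y
    rw [rieszKernel, rieszKernel, lintegral_lintegral_mul (by fun_prop) (by fun_prop)]
  simp_rw [h1]
  rw [lintegral_lintegral_swap]
  swap
  · exact (Measurable.lintegral_prod_right' (f := fun z : (V × ℝ) × ℝ =>
      ENNReal.ofReal (z.1.2 ^ (p - D - 1) * exp (-(π * ‖x - z.1.1‖ ^ 2 / z.1.2))) *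
        ENNReal.ofReal (z.2 ^ (q - D - 1) * exp (-(π * ‖z.1.1‖ ^ 2 / z.2))))
      (by fun_prop)).aemeasurable
  refine setLIntegral_congr_fun measurableSet_Ioi fun t (ht : 0 < t) => ?_
  rw [lintegral_lintegral_swap (by fun_prop)]
  refine setLIntegral_congr_fun measurableSet_Ioi fun s (hs : 0 < s) => ?_
  have h2 : ∀ y : V, ENNReal.ofReal (t ^ (p - D - 1) * exp (-(π * ‖x - y‖ ^ 2 / t))) *
        ENNReal.ofReal (s ^ (q - D - 1) * exp (-(π * ‖y‖ ^ 2 / s))) =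
      ENNReal.ofReal (t ^ (p - D - 1) * s ^ (q - D - 1)) *
        ENNReal.ofReal (exp (-(π * ‖x - y‖ ^ 2 / t)) * exp (-(π * ‖y‖ ^ 2 / s))) := by
    intro y
    rw [← ENNReal.ofReal_mul (by positivity), ← ENNReal.ofReal_mul (by positivity)]
    congr 1
    ring
  simp_rw [h2]
  rw [lintegral_const_mul' _ _ ENNReal.ofReal_ne_top, lintegral_exp_mul_exp ht hs,
    ← ENNReal.ofReal_mul (by positivity)]
  congr 1
  rw [← hD, div_rpow (by positivity) (by positivity), mul_rpow ht.le hs.le,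
    show p - D - 1 = p - 1 - D by ring, show q - D - 1 = q - 1 - D by ring, rpow_sub ht,
    rpow_sub hs, rpow_neg (by positivity)]
  have := rpow_pos_of_pos ht D
  have := rpow_pos_of_pos hs D
  have := rpow_pos_of_pos (add_pos ht hs) D
  field_simp

end Riesz

section Marginal

variable {W : Type*} [NormedAddCommGroup W] [InnerProductSpace ℝ W] [FiniteDimensional ℝ W]
  [MeasurableSpace W] [BorelSpace W]

/-- Integrating a power of the norm over the fibres of an orthogonal projection. -/
theorem lintegral_add_sq_norm_rpow {a b r : ℝ} (hb : 0 < b)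
    (hab : a = b + Module.finrank ℝ W / 2) (hr : 0 < r) :
    ∫⁻ w : W, ENNReal.ofReal ((r + ‖w‖ ^ 2) ^ (-a)) =
      ENNReal.ofReal (π ^ (Module.finrank ℝ W / 2 : ℝ) * Gamma b / Gamma a * r ^ (-b)) := by
  have ha : 0 < a := by rw [hab]; positivity
  have hGa := Gamma_pos_of_pos ha
  have hGb := Gamma_pos_of_pos hb
  have h1 : ∀ w : W, ENNReal.ofReal ((r + ‖w‖ ^ 2) ^ (-a)) = ENNReal.ofReal (Gamma a)⁻¹ *
      ∫⁻ t in Set.Ioi (0 : ℝ), ENNReal.ofReal (t ^ (a - 1) * exp (-((r + ‖w‖ ^ 2) * t))) := by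
    intro w
    rw [lintegral_rpow_mul_exp_neg_mul ha (by positivity), ← ENNReal.ofReal_mul (by positivity)]
    congr 1
    field_simp
  have h2 : ∀ t ∈ Set.Ioi (0 : ℝ),
      ∫⁻ w : W, ENNReal.ofReal (t ^ (a - 1) * exp (-((r + ‖w‖ ^ 2) * t))) =
      ENNReal.ofReal (π ^ (Module.finrank ℝ W / 2 : ℝ)) *
        ENNReal.ofReal (t ^ (b - 1) * exp (-(r * t))) := by
    intro t (ht : 0 < t)
    have h3 : ∀ w : W, t ^ (a - 1) * exp (-((r + ‖w‖ ^ 2) * t)) =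
        (t ^ (a - 1) * exp (-(r * t))) * exp (-t * ‖w‖ ^ 2) := by
      intro w
      rw [mul_assoc, ← exp_add]
      ring_nf
    simp_rw [h3, ENNReal.ofReal_mul (show 0 ≤ t ^ (a - 1) * exp (-(r * t)) by positivity)]
    rw [lintegral_const_mul' _ _ ENNReal.ofReal_ne_top, lintegral_exp_neg_mul_sq_norm ht,
      ← ENNReal.ofReal_mul (by positivity), ← ENNReal.ofReal_mul (by positivity)]
    congr 1
    rw [div_rpow pi_pos.le ht.le, hab, show b + (Module.finrank ℝ W : ℝ) / 2 - 1
      = b - 1 + Module.finrank ℝ W / 2 by ring, rpow_add ht]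
    have := rpow_pos_of_pos ht (Module.finrank ℝ W / 2 : ℝ)
    field_simp
  simp_rw [h1]
  rw [lintegral_const_mul' _ _ ENNReal.ofReal_ne_top, lintegral_lintegral_swap (by fun_prop),
    setLIntegral_congr_fun measurableSet_Ioi h2, lintegral_const_mul' _ _ ENNReal.ofReal_ne_top,
    lintegral_rpow_mul_exp_neg_mul hb hr, ← ENNReal.ofReal_mul (by positivity),
    ← ENNReal.ofReal_mul (by positivity)]
  congr 1
  field_simp

end Marginal

/-- The Schur test for a symmetric kernel with a weight `h`. -/
theorem lintegral_lintegral_mul_le_of_schur {X : Type*} [MeasurableSpace X] {μ : Measure X}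
    [SFinite μ] {a h : X → ℝ} {K : X → X → ℝ≥0∞} {U : X → ℝ≥0∞} (ha : Measurable a)
    (hh : Measurable h) (hK : Measurable (Function.uncurry K))
    (hsymm : ∀ x y, K x y = K y x) (hpos : ∀ᵐ x ∂μ, 0 < h x)
    (hU : ∀ᵐ x ∂μ, ∫⁻ y, K x y * ENNReal.ofReal (h y) ∂μ ≤ U x * ENNReal.ofReal (h x)) :
    ∫⁻ x, ∫⁻ y, ENNReal.ofReal (a x * a y) * K x y ∂μ ∂μ ≤
      ∫⁻ x, ENNReal.ofReal (a x ^ 2) * U x ∂μ := by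
  have hm : Measurable (Function.uncurry fun x y =>
      ENNReal.ofReal (a x ^ 2 / h x) * (K x y * ENNReal.ofReal (h y))) := by
    unfold Function.uncurry at hK ⊢
    fun_prop
  have h1 : ∫⁻ x, ∫⁻ y, ENNReal.ofReal (a x ^ 2 / h x) * (K x y * ENNReal.ofReal (h y)) ∂μ ∂μ ≤
      ∫⁻ x, ENNReal.ofReal (a x ^ 2) * U x ∂μ := by
    refine lintegral_mono_ae ?_
    filter_upwards [hpos, hU] with x hx hUx
    rw [lintegral_const_mul' _ _ ENNReal.ofReal_ne_top]
    calc _ ≤ ENNReal.ofReal (a x ^ 2 / h x) * (U x * ENNReal.ofReal (h x)) := by gcongr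
      _ = ENNReal.ofReal (a x ^ 2 / h x) * ENNReal.ofReal (h x) * U x := by ring
      _ = _ := by
        rw [← ENNReal.ofReal_mul (by positivity)]
        congr 2
        field_simp
  have h2 : ∫⁻ x, ∫⁻ y, ENNReal.ofReal (a y ^ 2 / h y) * (K y x * ENNReal.ofReal (h x)) ∂μ ∂μ =
      ∫⁻ x, ∫⁻ y, ENNReal.ofReal (a x ^ 2 / h x) * (K x y * ENNReal.ofReal (h y)) ∂μ ∂μ :=
    (lintegral_lintegral_swap hm.aemeasurable).symm
  have h3 : 2 * ∫⁻ x, ∫⁻ y, ENNReal.ofReal (a x * a y) * K x y ∂μ ∂μ ≤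
      2 * ∫⁻ x, ENNReal.ofReal (a x ^ 2) * U x ∂μ := by
    calc _ = ∫⁻ x, ∫⁻ y, 2 * (ENNReal.ofReal (a x * a y) * K x y) ∂μ ∂μ := by
          rw [← lintegral_const_mul' _ _ ENNReal.ofNat_ne_top]
          simp_rw [lintegral_const_mul' _ _ ENNReal.ofNat_ne_top]
      _ ≤ ∫⁻ x, ∫⁻ y, (ENNReal.ofReal (a x ^ 2 / h x) * (K x y * ENNReal.ofReal (h y)) +
            ENNReal.ofReal (a y ^ 2 / h y) * (K y x * ENNReal.ofReal (h x))) ∂μ ∂μ := by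
          refine lintegral_mono_ae ?_
          filter_upwards [hpos] with x hx
          refine lintegral_mono_ae ?_
          filter_upwards [hpos] with y hy
          have hp : 2 * (a x * a y) ≤ a x ^ 2 / h x * h y + a y ^ 2 / h y * h x := by
            rw [← sub_nonneg]
            have : a x ^ 2 / h x * h y + a y ^ 2 / h y * h x - 2 * (a x * a y) =
                (a x * h y - a y * h x) ^ 2 / (h x * h y) := by
              field_simp
              ring
            rw [this]
            positivity
          rw [← mul_assoc, hsymm y x]
          calc _ = ENNReal.ofReal (2 * (a x * a y)) * K x y := by
                rw [ENNReal.ofReal_mul (zero_le_two), ENNReal.ofReal_ofNat]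
            _ ≤ ENNReal.ofReal (a x ^ 2 / h x * h y + a y ^ 2 / h y * h x) * K x y := by gcongr
            _ = _ := by
              rw [ENNReal.ofReal_add (by positivity) (by positivity),
                ENNReal.ofReal_mul (by positivity), ENNReal.ofReal_mul (by positivity)]
              ring
      _ = 2 * ∫⁻ x, ∫⁻ y,
            ENNReal.ofReal (a x ^ 2 / h x) * (K x y * ENNReal.ofReal (h y)) ∂μ ∂μ := by
          rw [two_mul]
          conv_rhs => arg 2; rw [← h2]
          rw [← lintegral_add_left hm.lintegral_prod_right]
          refine lintegral_congr fun x => ?_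
          exact lintegral_add_left (hm.comp measurable_prodMk_left) _
      _ ≤ _ := by gcongr
  exact (ENNReal.mul_le_mul_iff_right two_ne_zero ENNReal.ofNat_ne_top).1 h3

section GaussianFourier

variable {V : Type*} [NormedAddCommGroup V] [InnerProductSpace ℝ V] [MeasurableSpace V]
  [BorelSpace V] {X : Type*} [MeasurableSpace X] {μ : Measure X}

theorem continuous_integral_cexp_inner_mul {m : X → ℂ} (hm : Integrable m μ) {P : X → V}
    (hP : Measurable P) :
    Continuous fun u : V => ∫ x, Complex.exp (2 * π * Complex.I * (⟪u, P x⟫_ℝ : ℂ)) * m x ∂μ := by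
  refine continuous_of_dominated (bound := fun x => ‖m x‖) (fun u => ?_) (fun u => ?_) hm.norm ?_
  · exact (Measurable.aestronglyMeasurable (by fun_prop)).mul hm.1
  · filter_upwards with x
    rw [norm_mul, show 2 * π * Complex.I * (⟪u, P x⟫_ℝ : ℂ) =
      ((2 * π * ⟪u, P x⟫_ℝ : ℝ) : ℂ) * Complex.I by push_cast; ring,
      Complex.norm_exp_ofReal_mul_I, one_mul]
  · filter_upwards with x
    fun_prop

variable [FiniteDimensional ℝ V] [SFinite μ]

/-- The `L²` norm, against a Gaussian, of the Fourier transform of the image of `m` under `P` is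
controlled by a quadratic form in `‖m‖` with Gaussian kernel. -/
theorem lintegral_exp_mul_sq_norm_integral_le {m : X → ℂ} (hm : Integrable m μ) {P : X → V}
    (hP : Measurable P) {t : ℝ} (ht : 0 < t) :
    ∫⁻ u : V, ENNReal.ofReal (exp (-(π * ‖u‖ ^ 2 * t)) *
        ‖∫ x, Complex.exp (2 * π * Complex.I * (⟪u, P x⟫_ℝ : ℂ)) * m x ∂μ‖ ^ 2) ≤
      ∫⁻ x, ∫⁻ y, ENNReal.ofReal (‖m x‖ * ‖m y‖) * ENNReal.ofReal
        (t ^ (-(Module.finrank ℝ V / 2 : ℝ)) * exp (-(π * ‖P x - P y‖ ^ 2 / t))) ∂μ ∂μ := by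
  set Φ : V → ℂ := fun u => ∫ x, Complex.exp (2 * π * Complex.I * (⟪u, P x⟫_ℝ : ℂ)) * m x ∂μ
  set M : X × X → ℂ := fun z => m z.1 * (starRingEnd ℂ) (m z.2)
  set G : V → ℂ := fun u => Complex.exp (-(π * t : ℝ) * ‖u‖ ^ 2)
  have hpt : 0 < π * t := by positivity
  have hM : Integrable M (μ.prod μ) := by
    have hc : Integrable (fun y => (starRingEnd ℂ) (m y)) μ :=
      (Complex.conjCLE.integrable_comp_iff (φ := m)).2 hm
    exact hm.mul_prod hc
  have hG : Integrable G := by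
    simpa [G] using GaussianFourier.integrable_cexp_neg_mul_sq_norm_add (V := V) (b := (π * t : ℝ))
      (by simpa using hpt) 0 0
  set F : V × (X × X) → ℂ := fun w =>
    Complex.exp (2 * π * Complex.I * (⟪w.1, P w.2.1 - P w.2.2⟫_ℝ : ℂ)) * (G w.1 * M w.2)
  have hF : Integrable F (volume.prod (μ.prod μ)) := by
    refine (hG.mul_prod hM).bdd_mul (c := 1) ?_ ?_
    · exact Measurable.aestronglyMeasurable (by fun_prop)
    · filter_upwards with w
      rw [show 2 * π * Complex.I * (⟪w.1, P w.2.1 - P w.2.2⟫_ℝ : ℂ) =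
        ((2 * π * ⟪w.1, P w.2.1 - P w.2.2⟫_ℝ : ℝ) : ℂ) * Complex.I by push_cast; ring,
        Complex.norm_exp_ofReal_mul_I]
  have hin : ∀ u, ∫ z, F (u, z) ∂(μ.prod μ) =
      ((exp (-(π * ‖u‖ ^ 2 * t)) * ‖Φ u‖ ^ 2 : ℝ) : ℂ) := by
    intro u
    have e1 : ∀ z, F (u, z) = G u *
        ((Complex.exp (2 * π * Complex.I * (⟪u, P z.1⟫_ℝ : ℂ)) * m z.1) *
          (starRingEnd ℂ) (Complex.exp (2 * π * Complex.I * (⟪u, P z.2⟫_ℝ : ℂ)) * m z.2)) := by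
      intro z
      simp only [F, M, map_mul, ← Complex.exp_conj, Complex.conj_ofReal, Complex.conj_I,
        Complex.conj_ofNat, inner_sub_right, Complex.ofReal_sub, mul_sub, Complex.exp_sub,
        mul_neg, neg_mul, Complex.exp_neg]
      ring
    simp_rw [e1]
    rw [integral_const_mul, integral_prod_mul (fun x =>
        Complex.exp (2 * π * Complex.I * (⟪u, P x⟫_ℝ : ℂ)) * m x) (fun y =>
        (starRingEnd ℂ) (Complex.exp (2 * π * Complex.I * (⟪u, P y⟫_ℝ : ℂ)) * m y)),
      integral_conj]
    rw [Complex.mul_conj, Complex.normSq_eq_norm_sq]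
    simp only [G, Φ]
    push_cast
    congr 3
    ring
  have hout : ∀ z : X × X, ∫ u, F (u, z) = M z *
      ((t ^ (-(Module.finrank ℝ V / 2 : ℝ)) * exp (-(π * ‖P z.1 - P z.2‖ ^ 2 / t)) : ℝ) : ℂ) := by
    intro z
    have e1 : ∀ u, F (u, z) = M z * Complex.exp (-(π * t : ℝ) * ‖u‖ ^ 2 +
        (2 * π * Complex.I) * ⟪P z.1 - P z.2, u⟫_ℝ) := by
      intro u
      simp only [F, G]
      rw [Complex.exp_add, real_inner_comm]
      ring
    simp_rw [e1]
    rw [integral_const_mul, GaussianFourier.integral_cexp_neg_mul_sq_norm_add (by simpa using hpt)]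
    congr 1
    rw [← Complex.ofReal_div, show (Module.finrank ℝ V : ℂ) / 2 =
      ((Module.finrank ℝ V / 2 : ℝ) : ℂ) by push_cast; rfl, ← Complex.ofReal_cpow (by positivity),
      Complex.ofReal_mul (t ^ _)]
    congr 1
    · rw [div_mul_cancel_left₀ pi_pos.ne', inv_rpow ht.le, rpow_neg ht.le]
    · rw [Complex.ofReal_exp]
      congr 1
      have : (π : ℂ) ≠ 0 := by exact_mod_cast pi_pos.ne'
      have : (t : ℂ) ≠ 0 := by exact_mod_cast ht.ne'
      push_cast
      field_simp
      rw [Complex.I_sq]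
      ring
  have hΦint : Integrable (fun u => exp (-(π * ‖u‖ ^ 2 * t)) * ‖Φ u‖ ^ 2) := by
    have := hF.integral_prod_left.norm
    simp_rw [hin] at this
    refine this.congr (Filter.Eventually.of_forall fun u => ?_)
    simp only [Complex.norm_real]
    exact norm_of_nonneg (by positivity)
  rw [← ofReal_integral_eq_lintegral_ofReal hΦint
    (Filter.Eventually.of_forall fun u => by positivity)]
  have hsw : ((∫ u, exp (-(π * ‖u‖ ^ 2 * t)) * ‖Φ u‖ ^ 2 : ℝ) : ℂ) =
      ∫ z, M z * ((t ^ (-(Module.finrank ℝ V / 2 : ℝ)) *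
        exp (-(π * ‖P z.1 - P z.2‖ ^ 2 / t)) : ℝ) : ℂ) ∂(μ.prod μ) := by
    rw [← integral_complex_ofReal]
    simp_rw [← hin, ← hout]
    exact integral_integral_swap hF
  have hMint : Integrable (fun z => M z * ((t ^ (-(Module.finrank ℝ V / 2 : ℝ)) *
        exp (-(π * ‖P z.1 - P z.2‖ ^ 2 / t)) : ℝ) : ℂ)) (μ.prod μ) := by
    simp_rw [← hout]
    exact hF.integral_prod_right
  calc _ ≤ ‖((∫ u, exp (-(π * ‖u‖ ^ 2 * t)) * ‖Φ u‖ ^ 2 : ℝ) : ℂ)‖ₑ := by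
        rw [← ofReal_norm, Complex.norm_real]
        exact ENNReal.ofReal_le_ofReal (le_norm_self _)
    _ ≤ _ := by
        rw [hsw]
        refine (enorm_integral_le_lintegral_enorm _).trans_eq ?_
        rw [lintegral_prod _ hMint.aestronglyMeasurable.enorm]
        refine lintegral_congr fun x => lintegral_congr fun y => ?_
        rw [← ENNReal.ofReal_mul (by positivity), ← ofReal_norm, norm_mul,
          Complex.norm_real, norm_of_nonneg (by positivity)]
        simp [M]

end GaussianFourier

open scoped FourierTransform

section Core

variable {V W : Type*} [NormedAddCommGroup V] [InnerProductSpace ℝ V] [FiniteDimensional ℝ V]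
  [MeasurableSpace V] [BorelSpace V] [NormedAddCommGroup W] [InnerProductSpace ℝ W]
  [FiniteDimensional ℝ W] [MeasurableSpace W] [BorelSpace W]

theorem ae_ne_zero_of_finrank_pos (hV : 0 < Module.finrank ℝ V) :
    ∀ᵐ v : V, v ≠ 0 := by
  have := Module.nontrivial_of_finrank_pos hV
  exact compl_mem_ae_iff.2 (measure_singleton 0)

/-- The eigenfunction identity behind the Schur test for the Riesz kernel on `V`, lifted to
`V × W`. -/
theorem lintegral_rieszKernel_mul_weight {p q a : ℝ} (hp : 0 < p) (hq : 0 < q)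
    (hpq : p + q < Module.finrank ℝ V / 2) (ha : a = p + Module.finrank ℝ W / 2)
    {v : V} (hv : v ≠ 0) :
    ∫⁻ y : V × W, rieszKernel p (v - y.1) * ENNReal.ofReal ((‖y.1‖ ^ 2 + ‖y.2‖ ^ 2) ^ (-a) *
        (‖y.1‖ ^ 2) ^ (p + q - Module.finrank ℝ V / 2)) =
      ENNReal.ofReal (π ^ (Module.finrank ℝ W / 2 + p) * (Gamma p / Gamma a) *
        (Gamma p * Gamma q * Gamma (Module.finrank ℝ V / 2 - p - q) /
          (Gamma (Module.finrank ℝ V / 2 - q) * Gamma (p + q))) *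
        (‖v‖ ^ 2) ^ (p + q - Module.finrank ℝ V / 2)) := by
  have hV : 0 < Module.finrank ℝ V := by
    have : (0 : ℝ) < Module.finrank ℝ V := by linarith
    exact_mod_cast this
  have hr := measurable_rieszKernel (V := V) p
  have ha0 : 0 < a := by rw [ha]; positivity
  set D : ℝ := Module.finrank ℝ V / 2 with hD
  set L : ℝ := Module.finrank ℝ W / 2 with hL
  have hGa := Gamma_pos_of_pos ha0
  have hGp := Gamma_pos_of_pos hp
  have hGq := Gamma_pos_of_pos hq
  have hGpq := Gamma_pos_of_pos (add_pos hp hq)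
  have hGd := Gamma_pos_of_pos (show 0 < D - q by linarith)
  have hfib : ∀ u : V, u ≠ 0 → ∫⁻ w : W, rieszKernel p (v - u) *
      ENNReal.ofReal ((‖u‖ ^ 2 + ‖w‖ ^ 2) ^ (-a) * (‖u‖ ^ 2) ^ (p + q - D)) =
      ENNReal.ofReal (π ^ L * Gamma p / Gamma a * (π ^ (D - q) / Gamma (D - q))) *
        (rieszKernel p (v - u) * rieszKernel q u) := by
    intro u hu
    have hu' : 0 < ‖u‖ ^ 2 := by positivity
    have e1 : ∀ w : W, ENNReal.ofReal ((‖u‖ ^ 2 + ‖w‖ ^ 2) ^ (-a) * (‖u‖ ^ 2) ^ (p + q - D)) =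
        ENNReal.ofReal ((‖u‖ ^ 2 + ‖w‖ ^ 2) ^ (-a)) * ENNReal.ofReal ((‖u‖ ^ 2) ^ (p + q - D)) :=
      fun w => ENNReal.ofReal_mul (by positivity)
    simp_rw [e1]
    rw [lintegral_const_mul _ (by fun_prop), lintegral_mul_const' _ _ ENNReal.ofReal_ne_top,
      lintegral_add_sq_norm_rpow hp ha hu', rieszKernel_eq (by linarith) hu, ← hD, ← hL,
      ← ENNReal.ofReal_mul (by positivity), mul_left_comm, ← ENNReal.ofReal_mul (by positivity)]
    congr 2
    rw [mul_rpow pi_pos.le hu'.le, show q - D = -(D - q) by ring, rpow_neg pi_pos.le,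
      show -(D - q) = -p + (p + q - D) by ring, rpow_add hu']
    have := rpow_pos_of_pos pi_pos (D - q)
    field_simp
  rw [Measure.volume_eq_prod, lintegral_prod _ (by fun_prop)]
  rw [lintegral_congr_ae ((ae_ne_zero_of_finrank_pos hV).mono hfib),
    lintegral_const_mul' _ _ ENNReal.ofReal_ne_top,
    lintegral_rieszKernel_mul_rieszKernel hp hq hpq hv, ← ENNReal.ofReal_mul (by positivity)]
  congr 1
  have hv' : 0 < ‖v‖ ^ 2 := by positivity
  rw [← hD, mul_rpow pi_pos.le hv'.le, show -(D - p - q) = p + q - D by ring,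
    show L + p = L + (D - q) + (p + q - D) by ring, rpow_add pi_pos, rpow_add pi_pos]
  field_simp

/-- A weighted `L²` bound for the restriction to `V` of the Fourier transform of an integrable
function on `V × W`. -/
theorem lintegral_rpow_mul_sq_norm_integral_le {m : V × W → ℂ} (hm : Integrable m)
    (hmm : Measurable m) {β : ℝ} (hβ : 0 < β) (hβV : β < Module.finrank ℝ V) :
    ∫⁻ u : V, ENNReal.ofReal (‖u‖ ^ (-β) *
        ‖∫ x, Complex.exp (2 * π * Complex.I * (⟪u, x.1⟫_ℝ : ℂ)) * m x‖ ^ 2) ≤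
      ENNReal.ofReal (π ^ (Module.finrank ℝ W / 2 + β) *
        (Gamma (β / 2) / Gamma ((Module.finrank ℝ W + β) / 2)) *
        (Gamma ((Module.finrank ℝ V - β) / 4) / Gamma ((Module.finrank ℝ V + β) / 4)) ^ 2) *
      ∫⁻ x : V × W, ENNReal.ofReal
        ((‖x.1‖ ^ 2 + ‖x.2‖ ^ 2) ^ ((Module.finrank ℝ W + β) / 2) * ‖m x‖ ^ 2) := by
  have hV : 0 < Module.finrank ℝ V := by
    have : (0 : ℝ) < Module.finrank ℝ V := by linarith
    exact_mod_cast this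
  set Φ : V → ℂ := fun u => ∫ x, Complex.exp (2 * π * Complex.I * (⟪u, x.1⟫_ℝ : ℂ)) * m x
  have hΦ : Continuous Φ := continuous_integral_cexp_inner_mul hm measurable_fst
  set p : ℝ := β / 2 with hp
  set q : ℝ := (Module.finrank ℝ V - β) / 4 with hq
  set a : ℝ := (Module.finrank ℝ W + β) / 2 with ha
  set D : ℝ := Module.finrank ℝ V / 2 with hD
  have hp0 : 0 < p := by positivity
  have hq0 : 0 < q := by rw [hq]; linarith
  have hpq : p + q < D := by rw [hp, hq, hD]; linarith
  have hG := Gamma_pos_of_pos hp0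
  have hr := measurable_rieszKernel (V := V) p
  have hsub : ∀ u : V, u ≠ 0 → ENNReal.ofReal (‖u‖ ^ (-β) * ‖Φ u‖ ^ 2) =
      ENNReal.ofReal (π ^ p / Gamma p) * ∫⁻ t in Set.Ioi (0 : ℝ), ENNReal.ofReal (t ^ (p - 1)) *
        ENNReal.ofReal (exp (-(π * ‖u‖ ^ 2 * t)) * ‖Φ u‖ ^ 2) := by
    intro u hu
    have hu' : 0 < ‖u‖ := norm_pos_iff.2 hu
    have e1 : ∀ t ∈ Set.Ioi (0 : ℝ), ENNReal.ofReal (t ^ (p - 1)) *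
        ENNReal.ofReal (exp (-(π * ‖u‖ ^ 2 * t)) * ‖Φ u‖ ^ 2) =
        ENNReal.ofReal (t ^ (p - 1) * exp (-(π * ‖u‖ ^ 2 * t))) * ENNReal.ofReal (‖Φ u‖ ^ 2) := by
      intro t (ht : 0 < t)
      rw [← ENNReal.ofReal_mul (by positivity), ← ENNReal.ofReal_mul (by positivity),
        mul_assoc (t ^ (p - 1))]
    rw [setLIntegral_congr_fun measurableSet_Ioi e1,
      lintegral_mul_const' _ _ ENNReal.ofReal_ne_top,
      lintegral_rpow_mul_exp_neg_mul hp0 (by positivity), ← ENNReal.ofReal_mul (by positivity),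
      ← ENNReal.ofReal_mul (by positivity)]
    congr 1
    rw [mul_rpow pi_pos.le (by positivity), ← rpow_natCast ‖u‖ 2, ← rpow_mul hu'.le,
      show ((2 : ℕ) : ℝ) * -p = -β by rw [hp]; push_cast; ring, rpow_neg pi_pos.le]
    have := rpow_pos_of_pos pi_pos p
    field_simp
  have hgauss : ∀ t ∈ Set.Ioi (0 : ℝ), ∫⁻ u : V, ENNReal.ofReal (t ^ (p - 1)) *
        ENNReal.ofReal (exp (-(π * ‖u‖ ^ 2 * t)) * ‖Φ u‖ ^ 2) ≤
      ∫⁻ x : V × W, ∫⁻ y : V × W, ENNReal.ofReal (‖m x‖ * ‖m y‖) * ENNReal.ofReal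
        (t ^ (p - D - 1) * exp (-(π * ‖x.1 - y.1‖ ^ 2 / t))) := by
    intro t (ht : 0 < t)
    rw [lintegral_const_mul' _ _ ENNReal.ofReal_ne_top]
    refine (mul_le_mul_right (lintegral_exp_mul_sq_norm_integral_le hm measurable_fst ht) _).trans_eq
      ?_
    rw [← lintegral_const_mul' _ _ ENNReal.ofReal_ne_top]
    refine lintegral_congr fun x => ?_
    rw [← lintegral_const_mul' _ _ ENNReal.ofReal_ne_top]
    refine lintegral_congr fun y => ?_
    rw [mul_left_comm, ← ENNReal.ofReal_mul (by positivity)]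
    congr 2
    rw [← mul_assoc, ← rpow_add ht, show p - 1 + -((Module.finrank ℝ V : ℝ) / 2) = p - D - 1 by
      rw [hD]; ring]
  have hschur : ∫⁻ x : V × W, ∫⁻ y : V × W, ENNReal.ofReal (‖m x‖ * ‖m y‖) *
        rieszKernel p (x.1 - y.1) ≤
      ∫⁻ x : V × W, ENNReal.ofReal (‖m x‖ ^ 2) *
        ENNReal.ofReal (π ^ (Module.finrank ℝ W / 2 + p) * (Gamma p / Gamma a) *
        (Gamma p * Gamma q * Gamma (D - p - q) / (Gamma (D - q) * Gamma (p + q))) *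
        (‖x.1‖ ^ 2 + ‖x.2‖ ^ 2) ^ a) := by
    have hae : ∀ᵐ x : V × W, x.1 ≠ 0 := Measure.quasiMeasurePreserving_fst.ae
      (ae_ne_zero_of_finrank_pos hV)
    refine lintegral_lintegral_mul_le_of_schur (a := fun x => ‖m x‖)
      (K := fun x y => rieszKernel p (x.1 - y.1))
      (h := fun y => (‖y.1‖ ^ 2 + ‖y.2‖ ^ 2) ^ (-a) * (‖y.1‖ ^ 2) ^ (p + q - D))
      (by fun_prop) (by fun_prop) ?_ (fun x y => ?_) ?_ ?_
    · exact hr.comp (by fun_prop)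
    · simp only [rieszKernel, norm_sub_rev]
    · filter_upwards [hae] with x hx
      positivity
    · filter_upwards [hae] with x hx
      have hx' : 0 < ‖x.1‖ ^ 2 + ‖x.2‖ ^ 2 := by positivity
      rw [lintegral_rieszKernel_mul_weight hp0 hq0 hpq (by rw [ha, hp]; ring) hx, ← hD,
        ← ENNReal.ofReal_mul' (by positivity)]
      refine ENNReal.ofReal_le_ofReal (le_of_eq ?_)
      rw [rpow_neg hx'.le]
      have := rpow_pos_of_pos hx' a
      field_simp
  calc ∫⁻ u : V, ENNReal.ofReal (‖u‖ ^ (-β) * ‖Φ u‖ ^ 2)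
    _ = ENNReal.ofReal (π ^ p / Gamma p) * ∫⁻ t in Set.Ioi (0 : ℝ), ∫⁻ u : V,
        ENNReal.ofReal (t ^ (p - 1)) *
          ENNReal.ofReal (exp (-(π * ‖u‖ ^ 2 * t)) * ‖Φ u‖ ^ 2) := by
        rw [lintegral_congr_ae ((ae_ne_zero_of_finrank_pos hV).mono hsub),
          lintegral_const_mul' _ _ ENNReal.ofReal_ne_top, lintegral_lintegral_swap (by fun_prop)]
    _ ≤ ENNReal.ofReal (π ^ p / Gamma p) * ∫⁻ t in Set.Ioi (0 : ℝ),
        ∫⁻ x : V × W, ∫⁻ y : V × W, ENNReal.ofReal (‖m x‖ * ‖m y‖) * ENNReal.ofReal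
          (t ^ (p - D - 1) * exp (-(π * ‖x.1 - y.1‖ ^ 2 / t))) := by
        exact mul_le_mul_right (setLIntegral_mono' measurableSet_Ioi hgauss) _
    _ = ENNReal.ofReal (π ^ p / Gamma p) * ∫⁻ x : V × W, ∫⁻ y : V × W,
        ENNReal.ofReal (‖m x‖ * ‖m y‖) * rieszKernel p (x.1 - y.1) := by
        congr 1
        rw [lintegral_lintegral_swap]
        swap
        · exact (Measurable.lintegral_prod_right' (f := fun z : (ℝ × (V × W)) × (V × W) =>
            ENNReal.ofReal (‖m z.1.2‖ * ‖m z.2‖) * ENNReal.ofReal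
              (z.1.1 ^ (p - D - 1) * exp (-(π * ‖z.1.2.1 - z.2.1‖ ^ 2 / z.1.1))))
            (by fun_prop)).aemeasurable
        refine lintegral_congr fun x => ?_
        rw [lintegral_lintegral_swap (by fun_prop)]
        refine lintegral_congr fun y => ?_
        rw [lintegral_const_mul' _ _ ENNReal.ofReal_ne_top, rieszKernel]
    _ ≤ _ := by
        refine (mul_le_mul_right hschur _).trans_eq ?_
        rw [← lintegral_const_mul' _ _ ENNReal.ofReal_ne_top,
          ← lintegral_const_mul' _ _ ENNReal.ofReal_ne_top]
        refine lintegral_congr fun x => ?_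
        have e1 : D - p - q = q := by rw [hD, hp, hq]; ring
        have e2 : D - q = (Module.finrank ℝ V + β) / 4 := by rw [hD, hq]; ring
        have e3 : p + q = (Module.finrank ℝ V + β) / 4 := by rw [hp, hq]; ring
        have hGq := Gamma_pos_of_pos hq0
        have hGa := Gamma_pos_of_pos (show 0 < a by rw [ha]; positivity)
        have hG4 := Gamma_pos_of_pos (show 0 < (Module.finrank ℝ V + β) / 4 by positivity)
        rw [e1, e2, e3, ← ENNReal.ofReal_mul (by positivity), ← ENNReal.ofReal_mul (by positivity),
          ← ENNReal.ofReal_mul (by positivity)]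
        congr 1
        rw [show (Module.finrank ℝ W : ℝ) / 2 + β = p + (Module.finrank ℝ W / 2 + p) by
          rw [hp]; ring, rpow_add pi_pos p]
        field_simp

variable {E : Type*} [NormedAddCommGroup E] [InnerProductSpace ℝ E] [FiniteDimensional ℝ E]
  [MeasurableSpace E] [BorelSpace E]

/-- `lintegral_rpow_mul_sq_norm_integral_le` transported along an orthogonal decomposition of the
ambient space. -/
theorem lintegral_rpow_mul_sq_norm_integral_le_of_isometry (e : E ≃ₗᵢ[ℝ] WithLp 2 (V × W))
    {m : E → ℂ} (hm : Integrable m) (hmm : Measurable m) {β : ℝ} (hβ : 0 < β)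
    (hβV : β < Module.finrank ℝ V) :
    ∫⁻ u : V, ENNReal.ofReal (‖u‖ ^ (-β) * ‖∫ ξ, Complex.exp (2 * π * Complex.I *
        (⟪e.symm (WithLp.toLp 2 (u, 0)), ξ⟫_ℝ : ℂ)) * m ξ‖ ^ 2) ≤
      ENNReal.ofReal (π ^ (Module.finrank ℝ W / 2 + β) *
        (Gamma (β / 2) / Gamma ((Module.finrank ℝ W + β) / 2)) *
        (Gamma ((Module.finrank ℝ V - β) / 4) / Gamma ((Module.finrank ℝ V + β) / 4)) ^ 2) *
      ∫⁻ ξ : E, ENNReal.ofReal (‖ξ‖ ^ (Module.finrank ℝ W + β) * ‖m ξ‖ ^ 2) := by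
  set ψ : V × W ≃ᵐ E := (MeasurableEquiv.toLp 2 (V × W)).trans e.symm.toMeasurableEquiv
  have hψ_apply : ∀ x, ψ x = e.symm (WithLp.toLp 2 x) := fun x => rfl
  have hψ : MeasurePreserving ψ :=
    e.symm.measurePreserving.comp (WithLp.volume_preserving_toLp V W)
  have hinner : ∀ (u : V) (x : V × W), ⟪e.symm (WithLp.toLp 2 (u, 0)), ψ x⟫_ℝ = ⟪u, x.1⟫_ℝ := by
    intro u x
    rw [hψ_apply, e.symm.inner_map_map, WithLp.prod_inner_apply]
    simp
  have hnorm : ∀ x : V × W, ‖ψ x‖ ^ (Module.finrank ℝ W + β) =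
      (‖x.1‖ ^ 2 + ‖x.2‖ ^ 2) ^ ((Module.finrank ℝ W + β) / 2) := by
    intro x
    rw [hψ_apply, e.symm.norm_map, WithLp.prod_norm_eq_of_L2, sqrt_eq_rpow,
      ← rpow_mul (by positivity)]
    congr 1
    ring
  have key := lintegral_rpow_mul_sq_norm_integral_le (m := m ∘ ψ)
    ((hψ.integrable_comp_emb ψ.measurableEmbedding).2 hm) (hmm.comp ψ.measurable) hβ hβV
  rw [← hψ.lintegral_comp_emb ψ.measurableEmbedding]
  simp_rw [← hψ.integral_comp ψ.measurableEmbedding (fun ξ => Complex.exp (2 * π * Complex.I *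
    (⟪e.symm (WithLp.toLp 2 (_, 0)), ξ⟫_ℝ : ℂ)) * m ξ), hinner, hnorm]
  exact key

theorem integral_cexp_mul_fourier_eq {g : E → ℂ} (hg : Integrable g) {c : ℝ} (hc : 0 < c)
    (v : E) :
    ∫ ξ : E, Complex.exp (2 * π * Complex.I * (⟪v, ξ⟫_ℝ : ℂ)) *
        (Complex.exp (-c⁻¹ * ‖ξ‖ ^ 2) * 𝓕 g ξ) =
      ∫ w : E, ((π * c : ℂ) ^ (Module.finrank ℝ E / 2 : ℂ) *
        Complex.exp (-π ^ 2 * c * ‖v - w‖ ^ 2)) • g w := by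
  have J : Integrable (fun w : E =>
      Complex.exp (-c⁻¹ * ‖w‖ ^ 2 + 2 * π * Complex.I * ⟪v, w⟫_ℝ)) :=
    GaussianFourier.integrable_cexp_neg_mul_sq_norm_add (by simpa) _ _
  have h := VectorFourier.integral_fourierIntegral_smul_eq_flip (L := innerₗ E)
      Real.continuous_fourierChar continuous_inner J hg
  have h' : ∫ ξ : E, 𝓕 (fun w : E =>
        Complex.exp (-c⁻¹ * ‖w‖ ^ 2 + 2 * π * Complex.I * ⟪v, w⟫_ℝ)) ξ • g ξ =
      ∫ ξ : E, Complex.exp (-c⁻¹ * ‖ξ‖ ^ 2 + 2 * π * Complex.I * ⟪v, ξ⟫_ℝ) • 𝓕 g ξ := by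
    simpa using! h
  calc _ = ∫ ξ : E, Complex.exp (-c⁻¹ * ‖ξ‖ ^ 2 + 2 * π * Complex.I * ⟪v, ξ⟫_ℝ) • 𝓕 g ξ := by
        congr with ξ
        rw [Complex.exp_add, smul_eq_mul]
        ring
    _ = _ := by
        rw [← h']
        congr with w
        rw [fourier_gaussian_innerProductSpace' (by simpa)]
        congr
        · simp
        · simp; ring

/-- The restriction inequality for a continuous integrable function, in terms of its Fourier
transform. -/
theorem lintegral_rpow_mul_sq_norm_le_fourier (e : E ≃ₗᵢ[ℝ] WithLp 2 (V × W))
    {g : E → ℂ} (hg : Integrable g) (hgc : Continuous g) {β : ℝ} (hβ : 0 < β)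
    (hβV : β < Module.finrank ℝ V) :
    ∫⁻ u : V, ENNReal.ofReal (‖u‖ ^ (-β) * ‖g (e.symm (WithLp.toLp 2 (u, 0)))‖ ^ 2) ≤
      ENNReal.ofReal (π ^ (Module.finrank ℝ W / 2 + β) *
        (Gamma (β / 2) / Gamma ((Module.finrank ℝ W + β) / 2)) *
        (Gamma ((Module.finrank ℝ V - β) / 4) / Gamma ((Module.finrank ℝ V + β) / 4)) ^ 2) *
      ∫⁻ ξ : E, ENNReal.ofReal (‖ξ‖ ^ (Module.finrank ℝ W + β) * ‖𝓕 g ξ‖ ^ 2) := by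
  have hFc : Continuous (𝓕 g) :=
    VectorFourier.fourierIntegral_continuous Real.continuous_fourierChar continuous_inner hg
  set c : ℕ → ℝ := fun N => N + 1
  have hc : ∀ N, 0 < c N := fun N => by positivity
  have hctop : Filter.Tendsto c Filter.atTop Filter.atTop :=
    Filter.tendsto_atTop_add_const_right _ _ tendsto_natCast_atTop_atTop
  set m : ℕ → E → ℂ := fun N ξ => Complex.exp (-(c N : ℂ)⁻¹ * ‖ξ‖ ^ 2) * 𝓕 g ξ
  have hmc : ∀ N, Continuous (m N) := fun N => by fun_prop
  have hm : ∀ N, Integrable (m N) := by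
    intro N
    have hG : Integrable fun ξ : E => Complex.exp (-(c N : ℂ)⁻¹ * ‖ξ‖ ^ 2) := by
      simpa using GaussianFourier.integrable_cexp_neg_mul_sq_norm_add (V := E)
        (b := (c N : ℂ)⁻¹) (by simpa using hc N) 0 0
    exact hG.mul_bdd (c := ∫ x, ‖g x‖) hFc.aestronglyMeasurable
      (Filter.Eventually.of_forall fun ξ =>
        VectorFourier.norm_fourierIntegral_le_integral_norm 𝐞 _ (innerₗ E) g ξ)
  have hmle : ∀ N ξ, ‖m N ξ‖ ≤ ‖𝓕 g ξ‖ := by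
    intro N ξ
    rw [norm_mul]
    refine mul_le_of_le_one_left (norm_nonneg _) ?_
    have := hc N
    rw [show -(c N : ℂ)⁻¹ * ‖ξ‖ ^ 2 = ((-((c N)⁻¹ * ‖ξ‖ ^ 2) : ℝ) : ℂ) by push_cast; ring,
      Complex.norm_exp_ofReal, exp_le_one_iff, neg_nonpos]
    positivity
  set J : V → E := fun u => e.symm (WithLp.toLp 2 (u, 0))
  have hJ : Continuous J := by fun_prop
  set φ : ℕ → V → ℂ := fun N u =>
    ∫ ξ, Complex.exp (2 * π * Complex.I * (⟪J u, ξ⟫_ℝ : ℂ)) * m N ξ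
  have hφ : ∀ N, Continuous (φ N) := fun N =>
    (continuous_integral_cexp_inner_mul (hm N) measurable_id).comp hJ
  have hlim : ∀ u, Filter.Tendsto (fun N => φ N u) Filter.atTop (nhds (g (J u))) := by
    intro u
    refine ((Real.tendsto_integral_gaussian_smul' hg hgc.continuousAt).comp hctop).congr fun N => ?_
    exact (integral_cexp_mul_fourier_eq hg (hc N) (J u)).symm.trans (by simp [φ, m])
  have hlim' : ∀ u, ENNReal.ofReal (‖u‖ ^ (-β) * ‖g (J u)‖ ^ 2) =
      Filter.liminf (fun N => ENNReal.ofReal (‖u‖ ^ (-β) * ‖φ N u‖ ^ 2)) Filter.atTop :=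
    fun u => (ENNReal.tendsto_ofReal (((hlim u).norm.pow 2).const_mul _)).liminf_eq.symm
  change ∫⁻ u : V, ENNReal.ofReal (‖u‖ ^ (-β) * ‖g (J u)‖ ^ 2) ≤ _
  rw [lintegral_congr hlim']
  refine (lintegral_liminf_le fun N => by have := hφ N; fun_prop).trans ?_
  refine Filter.liminf_le_of_le (by isBoundedDefault) fun b hb => ?_
  obtain ⟨N, hN⟩ := hb.exists
  refine hN.trans <| (lintegral_rpow_mul_sq_norm_integral_le_of_isometry e (hm N)
    (hmc N).measurable hβ hβV).trans ?_
  gcongr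
  exact hmle N _

end Core

theorem SchwartzMap.integrable_rpow_norm_mul {D : Type*} [NormedAddCommGroup D] [NormedSpace ℝ D]
    [MeasurableSpace D] [BorelSpace D] [SecondCountableTopology D] (μ : Measure D)
    [μ.HasTemperateGrowth] (f : SchwartzMap D ℂ) {s : ℝ} (hs : 0 ≤ s) :
    Integrable (fun x => ((‖x‖ ^ s : ℝ) : ℂ) * f x) μ := by
  obtain ⟨N, hN⟩ := exists_nat_ge s
  have hcont : Continuous fun x => ((‖x‖ ^ s : ℝ) : ℂ) * f x :=
    (Complex.continuous_ofReal.comp (continuous_norm.rpow_const fun _ => Or.inr hs)).mul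
      f.continuous
  refine (f.integrable.norm.add (f.integrable_pow_mul μ N)).mono' hcont.aestronglyMeasurable
    (Filter.Eventually.of_forall fun x => ?_)
  have h : ‖x‖ ^ s ≤ 1 + ‖x‖ ^ N := by
    rcases le_total ‖x‖ 1 with h1 | h1
    · have := rpow_le_one (norm_nonneg x) h1 hs
      have : 0 ≤ ‖x‖ ^ N := by positivity
      linarith
    · have := rpow_le_rpow_of_exponent_le h1 hN
      rw [rpow_natCast] at this
      linarith
  rw [norm_mul, Complex.norm_real, norm_of_nonneg (by positivity)]
  calc _ ≤ (1 + ‖x‖ ^ N) * ‖f x‖ := by gcongr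
    _ = _ := by simp only [Pi.add_apply]; ring

/-- The orthogonal decomposition `ℝ^(k + l) ≃ ℝ^k × ℝ^l`. -/
def euclideanSplit (k l : ℕ) : EuclideanSpace ℝ (Fin (k + l)) ≃ₗᵢ[ℝ]
    WithLp 2 (EuclideanSpace ℝ (Fin k) × EuclideanSpace ℝ (Fin l)) :=
  (LinearIsometryEquiv.piLpCongrLeft 2 ℝ ℝ finSumFinEquiv.symm).trans
    (PiLp.sumPiLpEquivProdLpPiLp 2 fun _ => ℝ)

theorem euclideanSplit_symm_apply_zero {k l : ℕ} (hkn : k ≤ k + l)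
    (u : EuclideanSpace ℝ (Fin k)) :
    (euclideanSplit k l).symm (WithLp.toLp 2 (u, 0)) = embedSub hkn u := by
  rw [LinearIsometryEquiv.symm_apply_eq]
  refine WithLp.ofLp_injective 2 (Prod.ext ?_ ?_) <;> ext i <;> simp [euclideanSplit, embedSub]

theorem norm_embedSub {k l : ℕ} (hkn : k ≤ k + l) (u : EuclideanSpace ℝ (Fin k)) :
    ‖embedSub hkn u‖ = ‖u‖ := by
  rw [← euclideanSplit_symm_apply_zero, LinearIsometryEquiv.norm_map, WithLp.prod_norm_eq_of_L2]
  simp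

/-- The constant of the restriction inequality is dominated by the reciprocal of the constant in
`lintegral_rpow_mul_sq_norm_le_fourier`. -/
theorem restriction_const_mul_le_one {k l β : ℝ} (hl : 0 ≤ l) (hβ : 0 < β) (hβk : β < k) :
    π ^ (-(l + β)) * (Gamma ((l + β) / 2) / Gamma (β / 2)) *
        (Gamma ((k + β) / 4) / Gamma ((k - β) / 4)) ^ 2 *
      (π ^ (l / 2 + β) * (Gamma (β / 2) / Gamma ((l + β) / 2)) *
        (Gamma ((k - β) / 4) / Gamma ((k + β) / 4)) ^ 2) ≤ 1 := by
  have h1 : Gamma (β / 2) ≠ 0 := (Gamma_pos_of_pos (by linarith)).ne'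
  have h2 : Gamma ((l + β) / 2) ≠ 0 := (Gamma_pos_of_pos (by linarith)).ne'
  have h3 : Gamma ((k - β) / 4) ≠ 0 := (Gamma_pos_of_pos (by linarith)).ne'
  have h4 : Gamma ((k + β) / 4) ≠ 0 := (Gamma_pos_of_pos (by linarith)).ne'
  calc _ = π ^ (-(l + β)) * π ^ (l / 2 + β) := by field_simp
    _ = π ^ (-(l / 2)) := by
        rw [← rpow_add pi_pos]
        congr 1
        ring
    _ ≤ 1 := rpow_le_one_of_one_le_of_nonpos (by linarith [pi_gt_three]) (by linarith)

/-- **Restriction uncertainty principle for linear subvarieties.**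
For `0 < β < k ≤ n`, `α = n − k + β`, `f` Schwartz, and `g(x) = |x|^{β/2} f(x)`,
`d · ∫_{ℝ^k} |f(u,0)|² du ≤ ∫ |ξ|^α |ĝ(ξ)|² dξ`. -/
theorem stmt12 (n k : ℕ) (hk : 1 ≤ k) (hkn : k ≤ n)
    (β : ℝ) (hβ0 : 0 < β) (hβk : β < k)
    (α : ℝ) (hα : α = (n : ℝ) - k + β)
    (f : SchwartzMap (EuclideanSpace ℝ (Fin n)) ℂ)
    (g : EuclideanSpace ℝ (Fin n) → ℂ)
    (hg : ∀ x, g x = (‖x‖ ^ (β / 2) : ℝ) * f x)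
    (ghat : EuclideanSpace ℝ (Fin n) → ℂ)
    (hghat : ∀ ξ, ghat ξ = ∫ x, Complex.exp (2 * Real.pi * Complex.I * (⟪x, ξ⟫_ℝ : ℂ)) * g x) :
    ENNReal.ofReal
        (Real.pi ^ (-α) * (Real.Gamma (α / 2) / Real.Gamma (β / 2)) *
          (Real.Gamma (((k : ℝ) + β) / 4) / Real.Gamma (((k : ℝ) - β) / 4)) ^ 2) *
      (∫⁻ u : EuclideanSpace ℝ (Fin k), (‖f (embedSub hkn u)‖₊ : ℝ≥0∞) ^ (2 : ℕ)) ≤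
    ∫⁻ ξ : EuclideanSpace ℝ (Fin n),
      ENNReal.ofReal (‖ξ‖ ^ α) * (‖ghat ξ‖₊ : ℝ≥0∞) ^ (2 : ℕ) := by
  obtain ⟨l, rfl⟩ := Nat.exists_eq_add_of_le hkn
  obtain rfl : α = l + β := by rw [hα]; push_cast; ring
  have hgfun : g = fun x => ((‖x‖ ^ (β / 2) : ℝ) : ℂ) * f x := funext hg
  have hgi : Integrable g := by
    rw [hgfun]
    exact f.integrable_rpow_norm_mul _ (by linarith)
  have hgc : Continuous g := by
    rw [hgfun]
    exact (Complex.continuous_ofReal.comp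
      (continuous_norm.rpow_const fun _ => Or.inr (by linarith))).mul f.continuous
  have hneg : ∀ ξ, ghat ξ = 𝓕 g (-ξ) := by
    intro ξ
    rw [hghat, fourier_eq']
    congr with x
    rw [inner_neg_right, smul_eq_mul]
    congr 2
    push_cast
    ring
  have hright : ∫⁻ ξ, ENNReal.ofReal (‖ξ‖ ^ (l + β)) * (‖ghat ξ‖₊ : ℝ≥0∞) ^ (2 : ℕ) =
      ∫⁻ ξ, ENNReal.ofReal (‖ξ‖ ^ (l + β) * ‖𝓕 g ξ‖ ^ 2) := by
    rw [← lintegral_neg_eq_self fun ξ => ENNReal.ofReal (‖ξ‖ ^ (l + β) * ‖𝓕 g ξ‖ ^ 2)]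
    refine lintegral_congr fun ξ => ?_
    rw [hneg, norm_neg, ENNReal.ofReal_mul (by positivity), ENNReal.ofReal_pow (norm_nonneg _),
      ofReal_norm]
    rfl
  have hleft : ∫⁻ u : EuclideanSpace ℝ (Fin k), (‖f (embedSub hkn u)‖₊ : ℝ≥0∞) ^ (2 : ℕ) =
      ∫⁻ u : EuclideanSpace ℝ (Fin k), ENNReal.ofReal (‖u‖ ^ (-β) *
        ‖g ((euclideanSplit k l).symm (WithLp.toLp 2 (u, 0)))‖ ^ 2) := by
    have : Nonempty (Fin k) := ⟨⟨0, hk⟩⟩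
    refine lintegral_congr_ae ?_
    filter_upwards [Measure.ae_ne volume (0 : EuclideanSpace ℝ (Fin k))] with u hu
    have hu' : 0 < ‖u‖ := norm_pos_iff.2 hu
    have hpow : ‖u‖ ^ (-β) * (‖u‖ ^ (β / 2)) ^ 2 = 1 := by
      rw [← rpow_natCast, ← rpow_mul hu'.le, ← rpow_add hu']
      norm_num
    rw [euclideanSplit_symm_apply_zero hkn, hg, norm_embedSub, norm_mul, Complex.norm_real,
      norm_of_nonneg (by positivity), mul_pow, ← mul_assoc, hpow, one_mul,
      ENNReal.ofReal_pow (norm_nonneg _), ofReal_norm]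
    rfl
  have key := lintegral_rpow_mul_sq_norm_le_fourier (euclideanSplit k l) hgi hgc hβ0 (by simpa)
  simp only [finrank_euclideanSpace_fin] at key
  rw [hleft, hright]
  refine (mul_le_mul_right key _).trans ?_
  rw [← mul_assoc, ← ENNReal.ofReal_mul' ?_]
  · refine mul_le_of_le_one_left zero_le (ENNReal.ofReal_le_one.2 ?_)
    exact restriction_const_mul_le_one l.cast_nonneg hβ0 hβk
  · have h1 := (Gamma_pos_of_pos (half_pos hβ0)).le
    have h2 := (Gamma_pos_of_pos (s := (l + β) / 2) (by positivity)).le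
    positivity
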